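/- arXiv:2506.01501 — 10 statements merged into one kernel-verified Lean document; each statement's English description precedes it below -/
import Mathlib

section
/- Let C be a locally finite category in which morphisms admit epi-mono factorization. Then for any pair of objects c, d of C, the cardinality |Hom_C(c,d)| equals the (finitely supported) sum, over all isomorphism classes of subobjects d' of d, of the number |Epi_C(c,d')| of epimorphisms from c to d'. -/
open CategoryTheory

universe v u

/-- Morphisms in `C` admit epi-mono factorization: every morphism factors as an epimorphism
followed by a monomorphism, uniquely up to isomorphism. -/
def HasEpiMonoFactorization (C : Type u) [Category.{v} C] : Prop :=
  ∀ ⦃a b : C⦄ (f : a ⟶ b), ∃ (m : C) (p : a ⟶ m) (i : m ⟶ b),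
    Epi p ∧ Mono i ∧ p ≫ i = f ∧
      ∀ (m' : C) (p' : a ⟶ m') (i' : m' ⟶ b), Epi p' → Mono i' → p' ≫ i' = f →
        ∃ δ : m ≅ m', p ≫ δ.hom = p' ∧ δ.hom ≫ i' = i

/-- The cardinality of a finite sigma type over an arbitrary index type is the finitely supported
sum of the cardinalities of the fibers. -/
theorem Nat.card_sigma_eq_finsum {ι : Type*} {β : ι → Type*} [Finite (Σ i, β i)] :
    Nat.card (Σ i, β i) = ∑ᶠ i, Nat.card (β i) := by
  classical
  have := Fintype.ofFinite (Σ i, β i)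
  have hsupp : (Function.support fun i => Nat.card (β i)) ⊆
      ((Finset.univ : Finset (Σ i, β i)).image Sigma.fst : Finset ι) := by
    intro i hi
    obtain ⟨⟨b⟩, -⟩ := Nat.card_ne_zero.mp hi
    exact Finset.mem_coe.mpr (Finset.mem_image.mpr ⟨⟨i, b⟩, Finset.mem_univ _, rfl⟩)
  rw [finsum_eq_sum_of_support_subset _ hsupp, Nat.card_eq_fintype_card, ← Finset.card_univ,
    Finset.card_eq_sum_card_image Sigma.fst]
  refine Finset.sum_congr rfl fun i _ => ?_
  rw [← Fintype.card_subtype, ← Nat.card_eq_fintype_card]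
  exact Nat.card_congr (Equiv.sigmaSubtype i)

/-- Composing with the inclusion of a subobject identifies pairs of a subobject `S` of `d` and an
epimorphism `c ⟶ S` with morphisms `c ⟶ d`. -/
theorem HasEpiMonoFactorization.bijective_comp_arrow {C : Type u} [Category.{v} C]
    (hfac : HasEpiMonoFactorization C) (c d : C) :
    Function.Bijective
      (fun x : Σ S : Subobject d, { f : c ⟶ Subobject.underlying.obj S // Epi f } =>
        x.2.1 ≫ x.1.arrow) := by
  constructor
  · rintro ⟨S, p, hp⟩ ⟨T, q, hq⟩ h
    obtain ⟨m, r, i, -, -, -, huniq⟩ := hfac (p ≫ S.arrow)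
    obtain ⟨δ, -, hδ⟩ := huniq _ p S.arrow hp inferInstance rfl
    obtain ⟨ε, -, hε⟩ := huniq _ q T.arrow hq inferInstance h.symm
    obtain rfl : S = T := Subobject.eq_of_comm (δ.symm ≪≫ ε) (by simp [hε, ← hδ])
    obtain rfl : p = q := (cancel_mono S.arrow).mp h
    rfl
  · intro f
    obtain ⟨m, p, i, hp, hi, hf, -⟩ := hfac f
    refine ⟨⟨Subobject.mk i, p ≫ (Subobject.underlyingIso i).inv, epi_comp _ _⟩, ?_⟩
    simp [hf]

/-- In a locally finite category with epi-mono factorizations, the number of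
morphisms `c ⟶ d` is the (finitely supported) sum, over all isomorphism classes of subobjects
`d'` of `d`, of the number of epimorphisms `c ⟶ d'`. -/
theorem homCount_eq_finsum_epiCount_subobjects (C : Type u) [Category.{v} C]
    (hlf : ∀ a b : C, Finite (a ⟶ b)) (hfac : HasEpiMonoFactorization C) (c d : C) :
    Nat.card (c ⟶ d) =
      ∑ᶠ S : Subobject d, Nat.card { f : c ⟶ Subobject.underlying.obj S // Epi f } := by
  have hbij := hfac.bijective_comp_arrow c d
  have := hlf c d
  have := Finite.of_injective _ hbij.injective
  rw [← Nat.card_sigma_eq_finsum]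
  exact (Nat.card_congr (Equiv.ofBijective _ hbij)).symm
end

section
/- Let C be a locally finite category and let a₁, …, aₙ be pairwise non-isomorphic objects of C. If integers λ₁, …, λₙ satisfy Σᵢ λᵢ · e_{aᵢ}(c) = 0 for every object c of C, then λᵢ = 0 for all i = 1, …, n. -/
open CategoryTheory

namespace CategoryTheory

/-- An epimorphism from an object to itself is invertible if there are only finitely many
endomorphisms. -/
theorem isIso_of_epi_of_finite_end {C : Type*} [Category C] {x : C} [Finite (x ⟶ x)]
    (f : x ⟶ x) [Epi f] : IsIso f := by
  have hinj : Function.Injective (fun g : x ⟶ x => f ≫ g) := fun _ _ h => (cancel_epi f).1 h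
  obtain ⟨g, hg⟩ := Finite.surjective_of_injective hinj (𝟙 x)
  have : IsSplitMono f := ⟨⟨⟨g, hg⟩⟩⟩
  exact isIso_of_epi_of_isSplitMono f

/-- If `x` has only finitely many endomorphisms, epimorphisms `x ⟶ y` and `y ⟶ x` are
isomorphisms. -/
theorem isIso_of_epi_of_epi_of_finite_end {C : Type*} [Category C] {x y : C} [Finite (x ⟶ x)]
    (f : x ⟶ y) (g : y ⟶ x) [Epi f] [Epi g] : IsIso f := by
  have := isIso_of_epi_of_finite_end (f ≫ g)
  have : IsSplitMono f := ⟨⟨⟨g ≫ inv (f ≫ g), by rw [← Category.assoc, IsIso.hom_inv_id]⟩⟩⟩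
  exact isIso_of_epi_of_isSplitMono f

end CategoryTheory

/-- In a locally finite category, if `a 0, …, a (n-1)` are pairwise
non-isomorphic objects and integers `lam i` satisfy `∑ i, lam i * e_{a i}(c) = 0` for every
object `c`, where `e_a(c)` is the number of epimorphisms `a ⟶ c`, then all `lam i = 0`. -/
theorem epiCount_linearIndependent (C : Type*) [Category C]
    (hlf : ∀ a b : C, Finite (a ⟶ b)) (n : ℕ) (a : Fin n → C)
    (hpair : ∀ i j, i ≠ j → ¬ Nonempty (a i ≅ a j)) (lam : Fin n → ℤ)
    (h : ∀ c : C, ∑ i, lam i * (Nat.card { f : a i ⟶ c // Epi f } : ℤ) = 0) :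
    ∀ i, lam i = 0 := by
  let r : Fin n → Fin n → Prop := fun j i => j ≠ i ∧ ∃ f : a j ⟶ a i, Epi f
  have : IsTrans (Fin n) r := ⟨by
    rintro i j k ⟨hij, f, hf⟩ ⟨-, g, hg⟩
    refine ⟨?_, f ≫ g, epi_comp f g⟩
    rintro rfl
    have := isIso_of_epi_of_epi_of_finite_end f g
    exact hpair i j hij ⟨asIso f⟩⟩
  have : Std.Irrefl r := ⟨fun _ hi => hi.1 rfl⟩
  intro i
  induction i using (Finite.wellFounded_of_trans_of_irrefl r).induction with
  | _ i ih =>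
    have hsum := h (a i)
    rw [Finset.sum_eq_single_of_mem i (Finset.mem_univ i)] at hsum
    · have : Nonempty { f : a i ⟶ a i // Epi f } := ⟨⟨𝟙 _, inferInstance⟩⟩
      have hpos : 0 < Nat.card { f : a i ⟶ a i // Epi f } := Nat.card_pos
      exact (mul_eq_zero.1 hsum).resolve_right (by exact_mod_cast hpos.ne')
    · intro j _ hji
      by_cases hepi : ∃ f : a j ⟶ a i, Epi f
      · rw [ih j ⟨hji, hepi⟩, zero_mul]
      · have : IsEmpty { f : a j ⟶ a i // Epi f } := ⟨fun f => hepi ⟨f.1, f.2⟩⟩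
        rw [Nat.card_of_isEmpty, Nat.cast_zero, mul_zero]
end

section
/- Let C be a category satisfying condition 𝕄 and let a₁, …, aₙ be objects of C. For any integers λ₁, …, λₙ, the equation Σᵢ λᵢ · h_{aᵢ}(c) = 0 holds for every object c of C if and only if the equation Σᵢ λᵢ · e_{aᵢ}(c) = 0 holds for every object c of C. -/
open CategoryTheory

universe v u

/-- Condition 𝕄: `C` is locally finite, morphisms admit epi-mono factorization, and for every
object `c` the poset of subobjects of `c`, ordered by `d ≤ d'` iff there is a monomorphism
`d ⟶ d'`, is well-founded (with respect to the associated strict order). -/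
def ConditionM (C : Type u) [Category.{v} C] : Prop :=
  (∀ a b : C, Finite (a ⟶ b)) ∧ HasEpiMonoFactorization C ∧
    ∀ c : C, WellFounded (fun S T : Subobject c =>
      (∃ f : Subobject.underlying.obj S ⟶ Subobject.underlying.obj T, Mono f) ∧
        ¬ ∃ f : Subobject.underlying.obj T ⟶ Subobject.underlying.obj S, Mono f)

namespace HasEpiMonoFactorization

variable {C : Type u} [Category.{v} C]

theorem exists_epi_comp_arrow (hF : HasEpiMonoFactorization C) {a c : C} (f : a ⟶ c) :
    ∃ (S : Subobject c) (q : a ⟶ (S : C)), Epi q ∧ q ≫ S.arrow = f := by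
  obtain ⟨m, p, i, hp, hi, rfl, -⟩ := hF f
  exact ⟨Subobject.mk i, p ≫ (Subobject.underlyingIso i).inv, epi_comp _ _, by simp⟩

theorem subobject_eq (hF : HasEpiMonoFactorization C) {a c : C} {S T : Subobject c}
    (p : a ⟶ (S : C)) (q : a ⟶ (T : C)) [Epi p] [Epi q] (h : p ≫ S.arrow = q ≫ T.arrow) :
    S = T := by
  obtain ⟨m, _, i, -, -, -, huniq⟩ := hF (p ≫ S.arrow)
  obtain ⟨δ, -, hδ⟩ := huniq _ p S.arrow inferInstance inferInstance rfl
  obtain ⟨ε, -, hε⟩ := huniq _ q T.arrow inferInstance inferInstance h.symm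
  refine Subobject.eq_of_comm (δ.symm ≪≫ ε) ?_
  simp [hε, ← hδ]

/-- The image of a morphism, as a subobject of its target. -/
noncomputable def image (hF : HasEpiMonoFactorization C) {a c : C} (f : a ⟶ c) : Subobject c :=
  (hF.exists_epi_comp_arrow f).choose

theorem exists_epi_comp_image_arrow (hF : HasEpiMonoFactorization C) {a c : C} (f : a ⟶ c) :
    ∃ q : a ⟶ (hF.image f : C), Epi q ∧ q ≫ (hF.image f).arrow = f :=
  (hF.exists_epi_comp_arrow f).choose_spec

theorem image_epi_comp_arrow (hF : HasEpiMonoFactorization C) {a c : C} {S : Subobject c}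
    (p : a ⟶ (S : C)) [Epi p] : hF.image (p ≫ S.arrow) = S := by
  obtain ⟨q, hq, h⟩ := hF.exists_epi_comp_image_arrow (p ≫ S.arrow)
  exact hF.subobject_eq q p h

theorem card_image_eq (hF : HasEpiMonoFactorization C) (a : C) {c : C} (S : Subobject c) :
    Nat.card { f : a ⟶ c // hF.image f = S } = Nat.card { p : a ⟶ (S : C) // Epi p } := by
  symm
  refine Nat.card_congr (Equiv.ofBijective
    (fun p => ⟨p.1 ≫ S.arrow, have := p.2; hF.image_epi_comp_arrow p.1⟩) ⟨?_, ?_⟩)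
  · intro p q h
    exact Subtype.ext ((cancel_mono S.arrow).1 (congrArg Subtype.val h))
  · rintro ⟨f, rfl⟩
    obtain ⟨q, hq, h⟩ := hF.exists_epi_comp_image_arrow f
    exact ⟨⟨q, hq⟩, Subtype.ext h⟩

/-- Sorting morphisms into `c` by their image expresses a combination of hom counts as a finite
sum, over subobjects of `c`, of the same combination of epimorphism counts. -/
theorem exists_finset_sum_homCount_eq (hF : HasEpiMonoFactorization C)
    (hfin : ∀ a b : C, Finite (a ⟶ b)) {ι : Type*} [Fintype ι] (a : ι → C) (lam : ι → ℤ) (c : C) :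
    ∃ t : Finset (Subobject c),
      (∀ S ∉ t, ∑ i, lam i * (Nat.card { p : a i ⟶ (S : C) // Epi p } : ℤ) = 0) ∧
      ∑ i, lam i * (Nat.card (a i ⟶ c) : ℤ) =
        ∑ S ∈ t, ∑ i, lam i * (Nat.card { p : a i ⟶ (S : C) // Epi p } : ℤ) := by
  classical
  have := fun i => Fintype.ofFinite (a i ⟶ c)
  let t : Finset (Subobject c) :=
    Finset.univ.biUnion fun i => Finset.univ.image fun f : a i ⟶ c => hF.image f
  have ht (i) (f : a i ⟶ c) : hF.image f ∈ t :=
    Finset.mem_biUnion.2 ⟨i, Finset.mem_univ i, Finset.mem_image_of_mem _ (Finset.mem_univ f)⟩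
  refine ⟨t, fun S hS => Finset.sum_eq_zero fun i _ => ?_, ?_⟩
  · have : IsEmpty { f : a i ⟶ c // hF.image f = S } := ⟨fun f => hS (f.2 ▸ ht i f.1)⟩
    rw [← hF.card_image_eq, Nat.card_of_isEmpty, Nat.cast_zero, mul_zero]
  · rw [Finset.sum_comm]
    refine Finset.sum_congr rfl fun i _ => ?_
    rw [← Finset.mul_sum, ← Nat.cast_sum, Nat.card_eq_fintype_card, ← Finset.card_univ,
      Finset.card_eq_sum_card_fiberwise (t := t) fun f _ => ht i f]
    congr 2
    refine Finset.sum_congr rfl fun S _ => ?_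
    rw [← hF.card_image_eq, Nat.card_eq_fintype_card, Fintype.card_subtype]

end HasEpiMonoFactorization

section

variable {C : Type u} [Category.{v} C]

theorem isIso_of_mono_of_finite_end {c : C} [Finite (c ⟶ c)] (f : c ⟶ c) [Mono f] : IsIso f := by
  obtain ⟨g, hg⟩ := Finite.surjective_of_injective
    (f := fun g : c ⟶ c => g ≫ f) (fun _ _ h => (cancel_mono f).1 h) (𝟙 c)
  have : IsSplitEpi f := IsSplitEpi.mk' ⟨g, hg⟩
  exact isIso_of_mono_of_isSplitEpi f

theorem isIso_of_mono_of_mono {c d : C} [Finite (c ⟶ c)] (i : d ⟶ c) (j : c ⟶ d) [Mono i]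
    [Mono j] : IsIso i := by
  have := isIso_of_mono_of_finite_end (j ≫ i)
  have : IsSplitEpi i := IsSplitEpi.mk' ⟨inv (j ≫ i) ≫ j, by simp⟩
  exact isIso_of_mono_of_isSplitEpi i

theorem card_epi_congr (a : C) {c d : C} (e : c ≅ d) :
    Nat.card { f : a ⟶ c // Epi f } = Nat.card { f : a ⟶ d // Epi f } := by
  refine Nat.card_congr (Equiv.subtypeEquiv e.homToEquiv fun f => ?_)
  refine ⟨fun _ => epi_comp f e.hom, fun (_ : Epi (f ≫ e.hom)) => ?_⟩
  simpa using epi_comp (f ≫ e.hom) e.inv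

end

/-- Under condition 𝕄, for objects `a 0, …, a (n-1)` and integers `lam i`,
`∑ i, lam i * h_{a i}(c) = 0` for every object `c` iff `∑ i, lam i * e_{a i}(c) = 0` for every
object `c`, where `h_a(c) = |Hom(a,c)|` and `e_a(c) = |Epi(a,c)|`. -/
theorem sum_homCount_eq_zero_iff_sum_epiCount_eq_zero (C : Type u) [Category.{v} C]
    (hM : ConditionM C) (n : ℕ) (a : Fin n → C) (lam : Fin n → ℤ) :
    (∀ c : C, ∑ i, lam i * (Nat.card (a i ⟶ c) : ℤ) = 0) ↔
      (∀ c : C, ∑ i, lam i * (Nat.card { f : a i ⟶ c // Epi f } : ℤ) = 0) := by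
  obtain ⟨hfin, hF, hwf⟩ := hM
  let E (c : C) : ℤ := ∑ i, lam i * (Nat.card { f : a i ⟶ c // Epi f } : ℤ)
  have hE {c d : C} (e : c ≅ d) : E c = E d :=
    Finset.sum_congr rfl fun i _ => by rw [card_epi_congr (a i) e]
  constructor
  · intro h c
    change E c = 0
    by_contra hc
    obtain ⟨S, hS, hmin⟩ := (hwf c).has_min {S : Subobject c | E (S : C) ≠ 0}
      ⟨⊤, by rwa [Set.mem_ofPred_eq, hE (asIso (⊤ : Subobject c).arrow)]⟩
    obtain ⟨t, ht, hsum⟩ := hF.exists_finset_sum_homCount_eq hfin a lam (S : C)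
    have hproper (T : Subobject (S : C)) (hT : T ≠ ⊤) : E (T : C) = 0 := by
      by_contra hT0
      let e := Subobject.underlyingIso (T.arrow ≫ S.arrow)
      refine hmin (Subobject.mk (T.arrow ≫ S.arrow)) (by rwa [Set.mem_ofPred_eq, hE e])
        ⟨⟨e.hom ≫ T.arrow, mono_comp _ _⟩, ?_⟩
      rintro ⟨j, hj⟩
      have := hfin (S : C) (S : C)
      have := isIso_of_mono_of_mono T.arrow (j ≫ e.hom)
      exact hT (Subobject.eq_top_of_isIso_arrow T)
    rw [h, Finset.sum_eq_single ⊤ (fun T _ => hproper T) (ht ⊤)] at hsum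
    exact hS ((hE (asIso (⊤ : Subobject (S : C)).arrow)).symm.trans hsum.symm)
  · intro h c
    obtain ⟨t, -, ht⟩ := hF.exists_finset_sum_homCount_eq hfin a lam c
    rw [ht]
    exact Finset.sum_eq_zero fun S _ => h _
end

section
/- Let C be a category satisfying condition 𝕄 and let a₁, …, aₙ be objects of C. Then the following are equivalent: (i) the objects a₁, …, aₙ are pairwise non-isomorphic; (ii) the functions h_{a₁}, …, h_{aₙ} are linearly independent; (iii) the functions e_{a₁}, …, e_{aₙ} are linearly independent. -/
open CategoryTheory

universe v u

theorem isIso_of_epi_of_finite_hom {C : Type u} [Category.{v} C] {a b : C} [Finite (a ⟶ a)]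
    (f : a ⟶ b) (g : b ⟶ a) [Epi f] [Epi g] : IsIso f := by
  have hinj : Function.Injective (fun k : a ⟶ a => (f ≫ g) ≫ k) :=
    fun k l h => (cancel_epi (f ≫ g)).1 h
  obtain ⟨k, hk⟩ := Finite.surjective_of_injective hinj (𝟙 a)
  have : IsSplitMono f := ⟨⟨⟨g ≫ k, by simpa using hk⟩⟩⟩
  exact isIso_of_epi_of_isSplitMono f

theorem isIso_of_mono_of_finite_hom {C : Type u} [Category.{v} C] {a b : C} [Finite (a ⟶ a)]
    (f : a ⟶ b) (g : b ⟶ a) [Mono f] [Mono g] : IsIso g := by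
  have hinj : Function.Injective (fun k : a ⟶ a => k ≫ (f ≫ g)) :=
    fun k l h => (cancel_mono (f ≫ g)).1 h
  obtain ⟨k, hk⟩ := Finite.surjective_of_injective hinj (𝟙 a)
  have : IsSplitEpi g := ⟨⟨⟨k ≫ f, by simpa using hk⟩⟩⟩
  exact isIso_of_mono_of_isSplitEpi g

theorem card_hom_congr_left {C : Type u} [Category.{v} C] {a b : C} (e : a ≅ b) (c : C) :
    Nat.card (a ⟶ c) = Nat.card (b ⟶ c) :=
  Nat.card_congr e.homFromEquiv

theorem card_epi_congr_right {C : Type u} [Category.{v} C] {c d : C} (e : c ≅ d) (a : C) :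
    Nat.card { f : a ⟶ c // Epi f } = Nat.card { f : a ⟶ d // Epi f } :=
  Nat.card_congr
    { toFun := fun f => ⟨f.1 ≫ e.hom, have := f.2; inferInstance⟩
      invFun := fun f => ⟨f.1 ≫ e.inv, have := f.2; inferInstance⟩
      left_inv := fun f => by simp
      right_inv := fun f => by simp }

/-- Composing an epimorphism onto a subobject of `d` with the inclusion into `d`. -/
noncomputable def epiSubobjectToHom {C : Type u} [Category.{v} C] (a d : C)
    (x : Σ T : Subobject d, { f : a ⟶ (T : C) // Epi f }) : a ⟶ d :=
  x.2.1 ≫ x.1.arrow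

theorem epiSubobjectToHom_bijective {C : Type u} [Category.{v} C]
    (hF : HasEpiMonoFactorization C) (a d : C) :
    Function.Bijective (epiSubobjectToHom a d) := by
  constructor
  · rintro ⟨S, p, hp⟩ ⟨T, q, hq⟩ h
    change p ≫ S.arrow = q ≫ T.arrow at h
    obtain ⟨m, r, i, -, -, -, huniq⟩ := hF (p ≫ S.arrow)
    obtain ⟨δ, -, hδ⟩ := huniq _ p S.arrow hp inferInstance rfl
    obtain ⟨ε, -, hε⟩ := huniq _ q T.arrow hq inferInstance h.symm
    obtain rfl : S = T := Subobject.eq_of_comm (δ.symm ≪≫ ε) (by simp [hε, ← hδ])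
    obtain rfl : p = q := (cancel_mono S.arrow).1 h
    rfl
  · intro f
    obtain ⟨m, p, i, hp, hi, hf, -⟩ := hF f
    refine ⟨⟨Subobject.mk i, p ≫ (Subobject.underlyingIso i).inv, inferInstance⟩, ?_⟩
    simp [epiSubobjectToHom, hf]

/-- Every subobject in the image of an epimorphism from `a` lies in a finite set, and summing the
numbers of epimorphisms over any larger finite set counts the morphisms out of `a`. -/
theorem exists_finset_card_hom_eq_sum_card_epi {C : Type u} [Category.{v} C]
    (hfin : ∀ a b : C, Finite (a ⟶ b)) (hF : HasEpiMonoFactorization C) (a d : C) :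
    ∃ F : Finset (Subobject d), ∀ G : Finset (Subobject d), F ⊆ G →
      Nat.card (a ⟶ d) = ∑ T ∈ G, Nat.card { f : a ⟶ (T : C) // Epi f } := by
  classical
  have := hfin a
  let e := Equiv.ofBijective _ (epiSubobjectToHom_bijective hF a d)
  have : Finite (Σ T : Subobject d, { f : a ⟶ (T : C) // Epi f }) := Finite.of_equiv _ e.symm
  refine ⟨(Set.finite_range
    (Sigma.fst : (Σ T : Subobject d, { f : a ⟶ (T : C) // Epi f }) → _)).toFinset,
    fun G hG => ?_⟩
  rw [← Finset.sum_coe_sort G, ← Nat.card_sigma, ← Nat.card_congr e]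
  exact Nat.card_congr
    { toFun := fun x => ⟨⟨x.1, hG (by simp)⟩, x.2⟩
      invFun := fun x => ⟨x.1.1, x.2⟩
      left_inv := fun _ => rfl
      right_inv := fun _ => rfl }

/-- If a combination of the functions `h_{a i}` vanishes identically, so does the corresponding
combination of the functions `e_{a i}`. -/
theorem sum_card_epi_eq_zero {C : Type u} [Category.{v} C] (hM : ConditionM C) {n : ℕ}
    (a : Fin n → C) (lam : Fin n → ℤ)
    (h : ∀ c : C, ∑ i, lam i * (Nat.card (a i ⟶ c) : ℤ) = 0) (c : C) :
    ∑ i, lam i * (Nat.card { f : a i ⟶ c // Epi f } : ℤ) = 0 := by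
  classical
  obtain ⟨hfin, hF, hwf⟩ := hM
  set E : C → ℤ := fun d => ∑ i, lam i * (Nat.card { f : a i ⟶ d // Epi f } : ℤ) with hE
  have hcongr {d d' : C} (e : d ≅ d') : E d = E d' := by
    simp only [hE, card_epi_congr_right e]
  have hsub (S : Subobject c) : E (S : C) = 0 := by
    induction S using (hwf c).induction with
    | _ S ih =>
    have hproper (T : Subobject (S : C)) (hT : T ≠ ⊤) : E (T : C) = 0 := by
      rw [hcongr (Subobject.underlyingIso (T.arrow ≫ S.arrow)).symm]
      refine ih _ ⟨⟨(Subobject.underlyingIso (T.arrow ≫ S.arrow)).hom ≫ T.arrow,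
        inferInstance⟩, ?_⟩
      rintro ⟨f, hf⟩
      have := hfin S S
      have := isIso_of_mono_of_finite_hom
        (f ≫ (Subobject.underlyingIso (T.arrow ≫ S.arrow)).hom) T.arrow
      exact hT (Subobject.eq_top_of_isIso_arrow T)
    choose F hFs using fun i => exists_finset_card_hom_eq_sum_card_epi hfin hF (a i) (S : C)
    let G := insert ⊤ (Finset.univ.biUnion F)
    have hG i : F i ⊆ G :=
      (Finset.subset_biUnion_of_mem F (Finset.mem_univ i)).trans (Finset.subset_insert _ _)
    have hsum : ∑ T ∈ G, E (T : C) = 0 := by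
      rw [← h (S : C), Finset.sum_comm]
      refine Finset.sum_congr rfl fun i _ => ?_
      rw [hFs i G (hG i), Nat.cast_sum, Finset.mul_sum]
    rw [Finset.sum_eq_single_of_mem ⊤ (Finset.mem_insert_self _ _)
      fun T _ hT => hproper T hT] at hsum
    rw [← hsum]
    exact hcongr (asIso (⊤ : Subobject (S : C)).arrow).symm
  exact (hcongr (asIso (⊤ : Subobject c).arrow)).symm.trans (hsub ⊤)

/-- The functions `e_{a i}` of pairwise non-isomorphic objects are linearly independent. -/
theorem epiCount_linIndep_of_pairwise_nonIso {C : Type u} [Category.{v} C]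
    (hfin : ∀ a b : C, Finite (a ⟶ b)) {n : ℕ} (a : Fin n → C)
    (ha : ∀ i j, i ≠ j → ¬ Nonempty (a i ≅ a j)) (lam : Fin n → ℤ)
    (h : ∀ c : C, ∑ i, lam i * (Nat.card { f : a i ⟶ c // Epi f } : ℤ) = 0) (i : Fin n) :
    lam i = 0 := by
  let r : Fin n → Fin n → Prop := fun j i => j ≠ i ∧ ∃ f : a j ⟶ a i, Epi f
  have hanti {i j : Fin n} (hij : i ≠ j) (f : a i ⟶ a j) (g : a j ⟶ a i) (_ : Epi f)
      (_ : Epi g) : False := by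
    have := hfin (a i) (a i)
    have := isIso_of_epi_of_finite_hom f g
    exact ha i j hij ⟨asIso f⟩
  have : IsTrans (Fin n) r := ⟨by
    rintro i j k ⟨hij, f, hf⟩ ⟨-, g, hg⟩
    refine ⟨?_, f ≫ g, inferInstance⟩
    rintro rfl
    exact hanti hij f g hf hg⟩
  have : Std.Irrefl r := ⟨fun i hi => hi.1 rfl⟩
  induction i using (Finite.wellFounded_of_trans_of_irrefl r).induction with
  | _ i ih =>
  have hi := h (a i)
  rw [Finset.sum_eq_single_of_mem i (Finset.mem_univ i)] at hi
  · refine (mul_eq_zero.1 hi).resolve_right ?_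
    have := hfin (a i) (a i)
    have : Nonempty { f : a i ⟶ a i // Epi f } := ⟨⟨𝟙 _, inferInstance⟩⟩
    exact_mod_cast Nat.card_pos.ne'
  · intro j _ hji
    by_cases hepi : ∃ f : a j ⟶ a i, Epi f
    · rw [ih j ⟨hji, hepi⟩, zero_mul]
    · have : IsEmpty { f : a j ⟶ a i // Epi f } := ⟨fun f => hepi ⟨f.1, f.2⟩⟩
      simp

/-- Linear independence of the functions `h_{a i}` forces the objects to be pairwise
non-isomorphic. -/
theorem pairwise_nonIso_of_homCount_linIndep {C : Type u} [Category.{v} C] {n : ℕ}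
    (a : Fin n → C)
    (h : ∀ lam : Fin n → ℤ,
      (∀ c : C, ∑ i, lam i * (Nat.card (a i ⟶ c) : ℤ) = 0) → ∀ i, lam i = 0)
    (i j : Fin n) (hij : i ≠ j) : ¬ Nonempty (a i ≅ a j) := by
  rintro ⟨e⟩
  have := h (Pi.single i 1 - Pi.single j 1) (fun c => by
    simp [sub_mul, Pi.single_apply, card_hom_congr_left e c]) i
  simp [hij] at this

/-- Under condition 𝕄, for objects `a 0, …, a (n-1)` the following are
equivalent: (i) they are pairwise non-isomorphic; (ii) the functions `h_{a i}` are linearly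
independent; (iii) the functions `e_{a i}` are linearly independent. -/
theorem pairwise_nonIso_iff_homCount_linIndep_iff_epiCount_linIndep
    (C : Type u) [Category.{v} C] (hM : ConditionM C) (n : ℕ) (a : Fin n → C) :
    List.TFAE
      [∀ i j, i ≠ j → ¬ Nonempty (a i ≅ a j),
       ∀ lam : Fin n → ℤ,
         (∀ c : C, ∑ i, lam i * (Nat.card (a i ⟶ c) : ℤ) = 0) → ∀ i, lam i = 0,
       ∀ lam : Fin n → ℤ,
         (∀ c : C, ∑ i, lam i * (Nat.card { f : a i ⟶ c // Epi f } : ℤ) = 0) →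
           ∀ i, lam i = 0] := by
  tfae_have 1 → 3 := epiCount_linIndep_of_pairwise_nonIso hM.1 a
  tfae_have 3 → 2 := fun h lam hlam => h lam (sum_card_epi_eq_zero hM a lam hlam)
  tfae_have 2 → 1 := pairwise_nonIso_of_homCount_linIndep a
  tfae_finish
end

section
/- Let C be a category satisfying condition 𝔼 and let a₁, …, aₙ be objects of C. Then the following are equivalent: (i) the objects a₁, …, aₙ are pairwise non-isomorphic; (ii) the functions h^{a₁}, …, h^{aₙ} are linearly independent; (iii) the functions m^{a₁}, …, m^{aₙ} are linearly independent. -/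
open CategoryTheory

universe v u

/-- Condition 𝔼: `C` is locally finite, morphisms admit epi-mono factorization, and for every
object `c` the poset of quotients of `c` (subobjects of `c` in the opposite category), ordered
by `d ≤ d'` iff there is an epimorphism `d' ⟶ d`, is well-founded (with respect to the
associated strict order). -/
def ConditionE (C : Type u) [Category.{v} C] : Prop :=
  (∀ a b : C, Finite (a ⟶ b)) ∧ HasEpiMonoFactorization C ∧
    ∀ c : C, WellFounded (fun S T : Subobject (Opposite.op c) =>
      (∃ f : (Subobject.underlying.obj T).unop ⟶ (Subobject.underlying.obj S).unop, Epi f) ∧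
        ¬ ∃ f : (Subobject.underlying.obj S).unop ⟶ (Subobject.underlying.obj T).unop, Epi f)

namespace CategoryTheory

variable {C : Type u} [Category.{v} C]

/-- If `a` has finitely many endomorphisms, then mutual monomorphisms are isomorphisms. -/
theorem isIso_of_mono_of_mono_of_finite {a b : C} [Finite (a ⟶ a)] (f : a ⟶ b) (g : b ⟶ a)
    [Mono f] [Mono g] : IsIso g := by
  have hinj : Function.Injective (fun k : a ⟶ a => k ≫ f ≫ g) := fun k l h =>
    (cancel_mono (f ≫ g)).1 h
  obtain ⟨k, hk⟩ := Finite.surjective_of_injective hinj (𝟙 a)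
  have : IsSplitEpi g := IsSplitEpi.mk' ⟨k ≫ f, by simpa using hk⟩
  exact isIso_of_mono_of_isSplitEpi g

/-- Isomorphic sources admit equally many monomorphisms to a given object. -/
theorem card_mono_congr_left {c d : C} (e : c ≅ d) (a : C) :
    Nat.card { f : c ⟶ a // Mono f } = Nat.card { f : d ⟶ a // Mono f } :=
  Nat.card_congr
    { toFun := fun f => ⟨e.inv ≫ f.1, have := f.2; inferInstance⟩
      invFun := fun f => ⟨e.hom ≫ f.1, have := f.2; inferInstance⟩
      left_inv := fun f => by simp
      right_inv := fun f => by simp }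

/-- A morphism out of `d` factors through a unique quotient of `d` by a monomorphism. -/
theorem _root_.HasEpiMonoFactorization.existsUnique_quotient (h : HasEpiMonoFactorization C)
    {d a : C} (f : d ⟶ a) :
    ∃! q : Subobject (Opposite.op d),
      ∃ g : (q : Cᵒᵖ).unop ⟶ a, Mono g ∧ q.arrow.unop ≫ g = f := by
  obtain ⟨m, p, i, hp, hi, hf, huniq⟩ := h f
  refine ⟨Subobject.mk p.op, ⟨(Subobject.underlyingIso p.op).inv.unop ≫ i, ?_, ?_⟩, ?_⟩
  · infer_instance
  · have := congrArg Quiver.Hom.unop (Subobject.underlyingIso_arrow p.op)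
    simp only [unop_comp, Quiver.Hom.unop_op] at this
    rw [← Category.assoc, this, hf]
  · rintro q ⟨g, hg, hq⟩
    obtain ⟨δ, hδ, -⟩ := huniq _ q.arrow.unop g inferInstance hg hq
    refine Subobject.eq_mk_of_comm p.op δ.op ?_
    rw [Iso.op_hom, ← op_comp, hδ, Quiver.Hom.op_unop]

/-- Morphisms `d ⟶ a` are counted by the monomorphisms to `a` from the quotients of `d`. -/
theorem _root_.HasEpiMonoFactorization.exists_card_hom_eq_sum (h : HasEpiMonoFactorization C)
    (d a : C) [Finite (d ⟶ a)] :
    ∃ T : Finset (Subobject (Opposite.op d)), ∀ T', T ⊆ T' →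
      Nat.card (d ⟶ a) = ∑ q ∈ T', Nat.card { g : (q : Cᵒᵖ).unop ⟶ a // Mono g } := by
  classical
  have := Fintype.ofFinite (d ⟶ a)
  choose K hK hKuniq using fun f : d ⟶ a => h.existsUnique_quotient f
  refine ⟨Finset.univ.image K, fun T' hT' => ?_⟩
  rw [Nat.card_eq_fintype_card, ← Finset.card_univ,
    Finset.card_eq_sum_card_fiberwise (f := K) (t := T')
      (fun f _ => hT' (Finset.mem_image_of_mem K (Finset.mem_univ f)))]
  refine Finset.sum_congr rfl fun q _ => ?_
  rw [← Fintype.card_subtype, ← Nat.card_eq_fintype_card]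
  refine (Nat.card_congr (Equiv.ofBijective
    (fun g => ⟨q.arrow.unop ≫ g.1, (hKuniq _ q ⟨g.1, g.2, rfl⟩).symm⟩) ⟨?_, ?_⟩)).symm
  · intro g g' hgg'
    exact Subtype.ext ((cancel_epi q.arrow.unop).1 (congrArg Subtype.val hgg'))
  · rintro ⟨f, rfl⟩
    obtain ⟨g, hg, hgf⟩ := hK f
    exact ⟨⟨g, hg⟩, Subtype.ext hgf⟩

/-- If a linear combination of the functions `h^{a i}` vanishes, so does the same linear
combination of the functions `m^{a i}`. -/
theorem sum_mul_card_mono_eq_zero (hE : ConditionE C) {ι : Type*} [Fintype ι] (a : ι → C)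
    (lam : ι → ℤ) (hlam : ∀ c : C, ∑ i, lam i * (Nat.card (c ⟶ a i) : ℤ) = 0) (c : C) :
    ∑ i, lam i * (Nat.card { f : c ⟶ a i // Mono f } : ℤ) = 0 := by
  classical
  obtain ⟨hfin, hfact, hwf⟩ := hE
  set F : C → ℤ := fun c => ∑ i, lam i * (Nat.card { f : c ⟶ a i // Mono f } : ℤ) with hF
  have hFiso : ∀ {c d : C}, (c ≅ d) → F c = F d := fun e => by
    simp only [hF, card_mono_congr_left e]
  have key : ∀ S : Subobject (Opposite.op c), F (S : Cᵒᵖ).unop = 0 := by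
    intro S
    induction S using (hwf c).induction with
    | h S ih =>
    set d : C := (S : Cᵒᵖ).unop
    choose T hT using fun i => hfact.exists_card_hom_eq_sum d (a i)
    have hsum := hlam d
    simp only [fun i => hT i (insert ⊤ (Finset.univ.biUnion T))
      ((Finset.subset_biUnion_of_mem T (Finset.mem_univ i)).trans (Finset.subset_insert _ _)),
      Nat.cast_sum, Finset.mul_sum] at hsum
    rw [Finset.sum_comm, Finset.sum_eq_single_of_mem ⊤ (Finset.mem_insert_self _ _)] at hsum
    · exact (hFiso (asIso (⊤ : Subobject (Opposite.op d)).arrow).unop).trans hsum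
    · intro q _ hq
      let R : Subobject (Opposite.op c) := Subobject.mk (q.arrow ≫ S.arrow)
      let e : (R : Cᵒᵖ) ≅ (q : Cᵒᵖ) := Subobject.underlyingIso (q.arrow ≫ S.arrow)
      have hR : F (R : Cᵒᵖ).unop = 0 := by
        refine ih R ⟨⟨(e.hom ≫ q.arrow).unop, inferInstance⟩, ?_⟩
        rintro ⟨f, hf⟩
        have : Finite (Opposite.op d ⟶ Opposite.op d) := Finite.of_equiv _ (opEquiv _ _).symm
        have : Mono (f.op ≫ e.hom) := mono_comp _ _
        have := isIso_of_mono_of_mono_of_finite (a := Opposite.op d) (f.op ≫ e.hom) q.arrow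
        exact hq ((Subobject.isIso_arrow_iff_eq_top q).1 this)
      exact (hFiso e.unop).trans hR
  exact (hFiso (asIso (⊤ : Subobject (Opposite.op c)).arrow).unop).trans (key ⊤)

/-- Pairwise non-isomorphic objects have linearly independent functions `m^{a i}`. -/
theorem eq_zero_of_sum_mul_card_mono_eq_zero (hfin : ∀ a b : C, Finite (a ⟶ b)) {ι : Type*}
    [Fintype ι] (a : ι → C) (ha : ∀ i j, i ≠ j → ¬ Nonempty (a i ≅ a j)) (lam : ι → ℤ)
    (hlam : ∀ c : C, ∑ i, lam i * (Nat.card { f : c ⟶ a i // Mono f } : ℤ) = 0) (i : ι) :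
    lam i = 0 := by
  classical
  by_contra hi
  let _ : Preorder ι :=
    { le := fun i j => ∃ f : a i ⟶ a j, Mono f
      le_refl := fun i => ⟨𝟙 _, inferInstance⟩
      le_trans := fun i j k ⟨f, _⟩ ⟨g, _⟩ => ⟨f ≫ g, mono_comp f g⟩ }
  obtain ⟨m, hm⟩ := (Set.toFinite {i | lam i ≠ 0}).exists_maximal ⟨i, hi⟩
  have hsum := hlam (a m)
  rw [Finset.sum_eq_single_of_mem m (Finset.mem_univ m)] at hsum
  · have : Nonempty { f : a m ⟶ a m // Mono f } := ⟨⟨𝟙 _, inferInstance⟩⟩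
    exact (mul_ne_zero hm.prop (Nat.cast_ne_zero.2 Nat.card_pos.ne')) hsum
  · intro j _ hj
    by_cases hlj : lam j = 0
    · simp [hlj]
    · have : IsEmpty { f : a m ⟶ a j // Mono f } := by
        refine ⟨fun ⟨f, hf⟩ => ?_⟩
        obtain ⟨g, hg⟩ := hm.le_of_ge hlj ⟨f, hf⟩
        have := isIso_of_mono_of_mono_of_finite f g
        exact ha j m hj ⟨asIso g⟩
      simp

/-- If isomorphic objects have the same function `N · a`, then objects whose functions are linearly
independent are pairwise non-isomorphic. -/
theorem not_nonempty_iso_of_linIndep {ι : Type*} [Fintype ι] (a : ι → C) (N : C → C → ℤ)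
    (hN : ∀ {a b : C}, (a ≅ b) → ∀ c, N c a = N c b)
    (hind : ∀ lam : ι → ℤ, (∀ c : C, ∑ i, lam i * N c (a i) = 0) → ∀ i, lam i = 0) (i j : ι)
    (hij : i ≠ j) : ¬ Nonempty (a i ≅ a j) := by
  classical
  rintro ⟨e⟩
  have := hind (Pi.single i 1 - Pi.single j 1)
    (fun c => by simp [sub_mul, Finset.sum_sub_distrib, Pi.single_apply, hN e c]) i
  simp [hij] at this

end CategoryTheory

/-- Under condition 𝔼, for objects `a 0, …, a (n-1)` the following are
equivalent: (i) they are pairwise non-isomorphic; (ii) the functions `h^{a i}(c) = |Hom(c, a i)|`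
are linearly independent; (iii) the functions `m^{a i}(c) = |Mono(c, a i)|` are linearly
independent. -/
theorem pairwise_nonIso_iff_homCount_linIndep_iff_monoCount_linIndep
    (C : Type u) [Category.{v} C] (hE : ConditionE C) (n : ℕ) (a : Fin n → C) :
    List.TFAE
      [∀ i j, i ≠ j → ¬ Nonempty (a i ≅ a j),
       ∀ lam : Fin n → ℤ,
         (∀ c : C, ∑ i, lam i * (Nat.card (c ⟶ a i) : ℤ) = 0) → ∀ i, lam i = 0,
       ∀ lam : Fin n → ℤ,
         (∀ c : C, ∑ i, lam i * (Nat.card { f : c ⟶ a i // Mono f } : ℤ) = 0) →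
           ∀ i, lam i = 0] := by
  tfae_have 1 → 3 := eq_zero_of_sum_mul_card_mono_eq_zero hE.1 a
  tfae_have 3 → 2 := fun h lam hlam => h lam (sum_mul_card_mono_eq_zero hE a lam hlam)
  tfae_have 2 → 1 := not_nonempty_iso_of_linIndep a (fun c b => (Nat.card (c ⟶ b) : ℤ))
    fun e c => congrArg Nat.cast (Nat.card_congr (e.homToEquiv (Z := c)))
  tfae_finish
end

section
/- Let C be a category satisfying condition 𝕄 and having finite coproducts, and let a₁, …, aₙ be objects of C. Then the following are equivalent: (i) the objects a₁, …, aₙ are free in the coproduct semigroup of C, i.e., for any two distinct n-tuples (k₁,…,kₙ) and (l₁,…,lₙ) of nonnegative integers, the coproducts a₁^{⊔k₁} ⊔ ⋯ ⊔ aₙ^{⊔kₙ} and a₁^{⊔l₁} ⊔ ⋯ ⊔ aₙ^{⊔lₙ} are non-isomorphic; (ii) the functions h_{a₁}, …, h_{aₙ} are algebraically independent over ℤ, i.e., if P ∈ ℤ[X₁,…,Xₙ] is a polynomial such that P(h_{a₁}(c), …, h_{aₙ}(c)) = 0 for all objects c of C, then P is the zero polynomial. -/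
open CategoryTheory

universe v u

open CategoryTheory.Limits

/-- The `k`-fold coproduct of an object with itself (the initial object when `k = 0`). -/
noncomputable def coprodPow {C : Type u} [Category.{v} C] [HasFiniteCoproducts C]
    (a : C) : ℕ → C
  | 0 => ⊥_ C
  | k + 1 => a ⨿ coprodPow a k

theorem isIso_of_mono_endo {C : Type u} [Category.{v} C] {x : C} [Finite (x ⟶ x)]
    (e : x ⟶ x) [Mono e] : IsIso e := by
  have hinj : Function.Injective (fun f : x ⟶ x => f ≫ e) :=
    fun f g h => (cancel_mono e).1 h
  obtain ⟨f, hf⟩ := (Finite.injective_iff_surjective.1 hinj) (𝟙 x)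
  have hf : f ≫ e = 𝟙 x := hf
  exact ⟨f, by rw [← cancel_mono e, Category.assoc, hf, Category.comp_id, Category.id_comp], hf⟩

theorem isIso_of_epi_endo {C : Type u} [Category.{v} C] {x : C} [Finite (x ⟶ x)]
    (e : x ⟶ x) [Epi e] : IsIso e := by
  have hinj : Function.Injective (fun f : x ⟶ x => e ≫ f) :=
    fun f g h => (cancel_epi e).1 h
  obtain ⟨f, hf⟩ := (Finite.injective_iff_surjective.1 hinj) (𝟙 x)
  have hf : e ≫ f = 𝟙 x := hf
  exact ⟨f, hf, by rw [← cancel_epi e, ← Category.assoc, hf, Category.comp_id, Category.id_comp]⟩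

theorem isIso_of_mono_of_mono_s11 {C : Type u} [Category.{v} C] {x y : C} [Finite (y ⟶ y)]
    (f : x ⟶ y) (g : y ⟶ x) [Mono f] [Mono g] : IsIso f := by
  have : IsIso (g ≫ f) := isIso_of_mono_endo _
  have : IsSplitEpi f :=
    ⟨⟨⟨inv (g ≫ f) ≫ g, by rw [Category.assoc, IsIso.inv_hom_id]⟩⟩⟩
  exact isIso_of_mono_of_isSplitEpi f

theorem isIso_of_epi_of_epi {C : Type u} [Category.{v} C] {x y : C} [Finite (x ⟶ x)]
    (f : x ⟶ y) (g : y ⟶ x) [Epi f] [Epi g] : IsIso f := by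
  have : IsIso (f ≫ g) := isIso_of_epi_endo _
  have : IsSplitMono f :=
    ⟨⟨⟨g ≫ inv (f ≫ g), by rw [← Category.assoc, IsIso.hom_inv_id]⟩⟩⟩
  exact isIso_of_epi_of_isSplitMono f

/-- The number of epimorphisms from `b` to `d`. -/
noncomputable def epiCount {C : Type u} [Category.{v} C] (b d : C) : ℕ :=
  Nat.card {e : b ⟶ d // Epi e}

theorem epiCount_congr {C : Type u} [Category.{v} C] (b : C) {d d' : C} (φ : d ≅ d') :
    epiCount b d = epiCount b d' := by
  refine Nat.card_congr ⟨fun e => ⟨e.1 ≫ φ.hom, ?_⟩, fun e => ⟨e.1 ≫ φ.inv, ?_⟩, ?_, ?_⟩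
  · have := e.2
    exact epi_comp _ _
  · have := e.2
    exact epi_comp _ _
  · intro e
    simp
  · intro e
    simp

/-- A morphism is determined by its image and an epimorphism onto the image. -/
theorem bijective_sigma_epi {C : Type u} [Category.{v} C] (hC : HasEpiMonoFactorization C)
    (b d : C) : Function.Bijective
      (fun x : Σ T : Subobject d, {e : b ⟶ (T : C) // Epi e} => x.2.1 ≫ x.1.arrow) := by
  constructor
  · rintro ⟨S, e, he⟩ ⟨T, e', he'⟩ (h : e ≫ S.arrow = e' ≫ T.arrow)
    obtain ⟨m, p, i, _, _, _, huniq⟩ := hC (e ≫ S.arrow)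
    obtain ⟨δ, _, hδ⟩ := huniq _ e S.arrow he inferInstance rfl
    obtain ⟨δ', _, hδ'⟩ := huniq _ e' T.arrow he' inferInstance h.symm
    obtain rfl : S = T :=
      Subobject.eq_of_comm (δ.symm ≪≫ δ') (by simp [hδ', ← hδ])
    obtain rfl : e = e' := (cancel_mono S.arrow).1 h
    rfl
  · intro f
    obtain ⟨m, p, i, hp, hi, hf, _⟩ := hC f
    refine ⟨⟨Subobject.mk i, p ≫ (Subobject.underlyingIso i).inv, epi_comp _ _⟩, ?_⟩
    simp [hf]

theorem exists_card_hom_eq_sum_epiCount {C : Type u} [Category.{v} C]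
    (hC : HasEpiMonoFactorization C) (b d : C) [Finite (b ⟶ d)] :
    ∃ s : Finset (Subobject d), ∀ t : Finset (Subobject d), s ⊆ t →
      Nat.card (b ⟶ d) = ∑ T ∈ t, epiCount b (T : C) := by
  classical
  let φ := Equiv.ofBijective _ (bijective_sigma_epi hC b d)
  have : Finite (Σ T : Subobject d, {e : b ⟶ (T : C) // Epi e}) := Finite.of_equiv _ φ.symm
  refine ⟨(Set.finite_range (fun x : Σ T : Subobject d, {e : b ⟶ (T : C) // Epi e} =>
    x.1)).toFinset, fun t ht => ?_⟩
  have (T : Subobject d) : Finite {e : b ⟶ (T : C) // Epi e} :=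
    Finite.of_injective (fun e => (⟨T, e⟩ : Σ T : Subobject d, {e : b ⟶ (T : C) // Epi e}))
      (fun _ _ h => eq_of_heq (Sigma.mk.inj h).2)
  let ψ : (Σ T : t, {e : b ⟶ ((T : Subobject d) : C) // Epi e}) ≃
      (Σ T : Subobject d, {e : b ⟶ (T : C) // Epi e}) :=
    Equiv.ofBijective (fun x => ⟨x.1, x.2⟩) (by
      constructor
      · rintro ⟨⟨S, hS⟩, e⟩ ⟨⟨T, hT⟩, e'⟩ h
        cases h
        rfl
      · rintro ⟨T, e⟩
        exact ⟨⟨⟨T, ht (by simpa using ⟨e.1, e.2⟩)⟩, e⟩, rfl⟩)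
  rw [← Nat.card_congr (ψ.trans φ), Nat.card_sigma]
  exact Finset.sum_coe_sort t (fun T => epiCount b (T : C))

theorem sum_epiCount_eq_zero {C : Type u} [Category.{v} C] (hM : ConditionM C)
    {ι : Type*} (s : Finset ι) (b : ι → C) (w : ι → ℤ)
    (h : ∀ c : C, ∑ j ∈ s, w j * (Nat.card (b j ⟶ c) : ℤ) = 0) (c : C) :
    ∑ j ∈ s, w j * (epiCount (b j) c : ℤ) = 0 := by
  classical
  obtain ⟨hfin, hC, hwf⟩ := hM
  have key : ∀ S : Subobject c, ∑ j ∈ s, w j * (epiCount (b j) (S : C) : ℤ) = 0 := by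
    intro S
    induction S using (hwf c).induction with
    | _ S ih =>
    choose t ht using fun j => exists_card_hom_eq_sum_epiCount hC (b j) (S : C)
    have hsum := h (S : C)
    have hcard : ∀ j ∈ s, w j * (Nat.card (b j ⟶ (S : C)) : ℤ) =
        ∑ T ∈ insert ⊤ (s.biUnion t), w j * (epiCount (b j) (T : C) : ℤ) := by
      intro j hj
      rw [ht j _ ((Finset.subset_biUnion_of_mem t hj).trans (Finset.subset_insert _ _)),
        Nat.cast_sum, Finset.mul_sum]
    rw [Finset.sum_congr rfl hcard, Finset.sum_comm,
      Finset.sum_eq_single_of_mem ⊤ (Finset.mem_insert_self _ _)] at hsum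
    · rw [← hsum]
      exact Finset.sum_congr rfl fun j _ => by
        rw [epiCount_congr (b j) (asIso (⊤ : Subobject (S : C)).arrow)]
    · intro T _ hT
      have hstrict := ih (Subobject.mk (T.arrow ≫ S.arrow))
        ⟨⟨(Subobject.underlyingIso (T.arrow ≫ S.arrow)).hom ≫ T.arrow, mono_comp _ _⟩, ?_⟩
      · rw [← hstrict]
        exact Finset.sum_congr rfl fun j _ => by
          rw [epiCount_congr (b j) (Subobject.underlyingIso (T.arrow ≫ S.arrow))]
      · rintro ⟨g, hg⟩
        have := mono_comp g (Subobject.underlyingIso (T.arrow ≫ S.arrow)).hom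
        have := isIso_of_mono_of_mono_s11 T.arrow
          (g ≫ (Subobject.underlyingIso (T.arrow ≫ S.arrow)).hom)
        exact hT (Subobject.eq_top_of_isIso_arrow T)
  rw [← key ⊤]
  exact Finset.sum_congr rfl fun j _ => by
    rw [epiCount_congr (b j) (asIso (⊤ : Subobject c).arrow)]

/-- Hom-counting functions of pairwise non-isomorphic objects are linearly independent. -/
theorem homCount_linearIndependent {C : Type u} [Category.{v} C] (hM : ConditionM C)
    {ι : Type*} (s : Finset ι) (b : ι → C) (hb : ∀ i j, Nonempty (b i ≅ b j) → i = j)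
    (w : ι → ℤ) (h : ∀ c : C, ∑ j ∈ s, w j * (Nat.card (b j ⟶ c) : ℤ) = 0) :
    ∀ j ∈ s, w j = 0 := by
  classical
  have := hM.1
  by_contra! hne
  let : Preorder ι :=
    { le := fun i j => ∃ f : b i ⟶ b j, Epi f
      le_refl := fun i => ⟨𝟙 _, inferInstance⟩
      le_trans := fun i j k ⟨f, _⟩ ⟨g, _⟩ => ⟨f ≫ g, epi_comp _ _⟩ }
  obtain ⟨j, hj⟩ := (s.filter (fun j => w j ≠ 0)).exists_minimal
    (by obtain ⟨j, hj, hw⟩ := hne; exact ⟨j, by simp [hj, hw]⟩)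
  obtain ⟨hjs, hwj⟩ := Finset.mem_filter.1 hj.prop
  have hsum := sum_epiCount_eq_zero hM s b w h (b j)
  rw [Finset.sum_eq_single_of_mem j hjs] at hsum
  · have : Nonempty {e : b j ⟶ b j // Epi e} := ⟨⟨𝟙 _, inferInstance⟩⟩
    have hpos : 0 < epiCount (b j) (b j) := Nat.card_pos
    rcases mul_eq_zero.1 hsum with h0 | h0
    · exact hwj h0
    · omega
  · intro i hi hij
    by_cases hwi : w i = 0
    · rw [hwi, zero_mul]
    have hempty : IsEmpty {e : b i ⟶ b j // Epi e} := by
      refine ⟨fun ⟨e, he⟩ => ?_⟩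
      obtain ⟨g, hg⟩ : ∃ g : b j ⟶ b i, Epi g :=
        hj.le_of_le (Finset.mem_filter.2 ⟨hi, hwi⟩) ⟨e, he⟩
      have := isIso_of_epi_of_epi e g
      exact hij (hb i j ⟨asIso e⟩)
    simp [epiCount]

theorem card_coprodPow_hom {C : Type u} [Category.{v} C] [HasFiniteCoproducts C]
    (a c : C) (k : ℕ) : Nat.card (coprodPow a k ⟶ c) = Nat.card (a ⟶ c) ^ k := by
  induction k with
  | zero =>
    rw [pow_zero]
    exact Nat.card_unique (α := ⊥_ C ⟶ c)
  | succ k ih =>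
    let φ : (coprodPow a (k + 1) ⟶ c) ≃ (a ⟶ c) × (coprodPow a k ⟶ c) :=
      { toFun := fun f => ((coprod.inl : a ⟶ a ⨿ coprodPow a k) ≫ f,
          (coprod.inr : coprodPow a k ⟶ a ⨿ coprodPow a k) ≫ f)
        invFun := fun p => coprod.desc p.1 p.2
        left_inv := fun f => coprod.hom_ext (coprod.inl_desc _ _) (coprod.inr_desc _ _)
        right_inv := fun p => Prod.ext (coprod.inl_desc _ _) (coprod.inr_desc _ _) }
    rw [Nat.card_congr φ, Nat.card_prod, ih, pow_succ']

theorem card_sigma_coprodPow_hom {C : Type u} [Category.{v} C] [HasFiniteCoproducts C]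
    {n : ℕ} (a : Fin n → C) (k : Fin n → ℕ) (c : C) :
    Nat.card ((∐ fun i => coprodPow (a i) (k i)) ⟶ c) =
      ∏ i, Nat.card (a i ⟶ c) ^ k i := by
  let φ : ((∐ fun i => coprodPow (a i) (k i)) ⟶ c) ≃ ∀ i, (coprodPow (a i) (k i) ⟶ c) :=
    { toFun := fun f i => Sigma.ι (fun i => coprodPow (a i) (k i)) i ≫ f
      invFun := fun p => Sigma.desc p
      left_inv := fun f => Sigma.hom_ext _ _ fun i => by simp
      right_inv := fun p => funext fun i => by simp }
  rw [Nat.card_congr φ, Nat.card_pi]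
  exact Finset.prod_congr rfl fun i _ => card_coprodPow_hom _ _ _

/-- Under condition 𝕄, in a category with finite coproducts, objects
`a 0, …, a (n-1)` are free in the coproduct semigroup (distinct tuples of multiplicities give
non-isomorphic coproducts) iff the functions `h_{a i}(c) = |Hom(a i, c)|` are algebraically
independent over `ℤ`. -/
theorem free_in_coprod_semigroup_iff_homCount_algIndep (C : Type u) [Category.{v} C]
    [HasFiniteCoproducts C] (hM : ConditionM C) (n : ℕ) (a : Fin n → C) :
    (∀ k l : Fin n → ℕ, k ≠ l →
        ¬ Nonempty ((∐ fun i => coprodPow (a i) (k i)) ≅ ∐ fun i => coprodPow (a i) (l i))) ↔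
      ∀ P : MvPolynomial (Fin n) ℤ,
        (∀ c : C, MvPolynomial.eval (fun i => (Nat.card (a i ⟶ c) : ℤ)) P = 0) → P = 0 := by
  constructor
  · intro hfree P hP
    refine MvPolynomial.support_eq_empty.1 (Finset.eq_empty_of_forall_notMem fun m hm => ?_)
    refine MvPolynomial.mem_support_iff.1 hm (homCount_linearIndependent hM P.support
      (fun m => ∐ fun i => coprodPow (a i) (m i)) (fun m m' hiso => ?_)
      (fun m => P.coeff m) (fun c => ?_) m hm)
    · by_contra hne
      exact hfree m m' (fun h => hne (DFunLike.coe_injective h)) hiso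
    · rw [← hP c, MvPolynomial.eval_eq']
      refine Finset.sum_congr rfl fun m _ => ?_
      rw [card_sigma_coprodPow_hom]
      push_cast
      rfl
  · rintro hind k l hkl ⟨φ⟩
    have hP := hind (MvPolynomial.monomial (Finsupp.equivFunOnFinite.symm k) 1 -
      MvPolynomial.monomial (Finsupp.equivFunOnFinite.symm l) 1) fun c => by
        have hcard := Nat.card_congr (φ.homCongr (Iso.refl c))
        rw [card_sigma_coprodPow_hom, card_sigma_coprodPow_hom] at hcard
        have hcast : (∏ i, (Nat.card (a i ⟶ c) : ℤ) ^ k i) =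
            ∏ i, (Nat.card (a i ⟶ c) : ℤ) ^ l i := by exact_mod_cast hcard
        simp [MvPolynomial.eval_monomial, Finsupp.prod_fintype, hcast]
    have hmon := MvPolynomial.monomial_left_injective (one_ne_zero (α := ℤ)) (sub_eq_zero.1 hP)
    exact hkl (Finsupp.equivFunOnFinite.symm.injective hmon)
end

section
/- Let G₁ and G₂ be finite groups. The following are equivalent: (i) G₁ ≅ G₂; (ii) there exists a surjective group homomorphism f : G₁ → G₂ and |Hom(G₁,G₁)| = |Hom(G₂,G₁)|; (iii) there exists an injective group homomorphism f : G₁ → G₂ and |Hom(G₂,G₁)| = |Hom(G₂,G₂)|. -/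
/-- A surjective homomorphism `f : G →* H` of finite groups has a left inverse as soon as
`|Hom(G,G)| = |Hom(H,G)|`, since precomposition with `f` is then a bijection. -/
theorem MonoidHom.exists_comp_eq_id_of_surjective {G H : Type*} [Group G] [Group H]
    [Finite G] (f : G →* H) (hf : Function.Surjective f)
    (hcard : Nat.card (G →* G) = Nat.card (H →* G)) :
    ∃ g : H →* G, g.comp f = MonoidHom.id G := by
  have : Finite (G →* G) := DFunLike.finite _
  have hinj : Function.Injective fun g : H →* G => g.comp f :=
    fun _ _ h => (MonoidHom.cancel_right hf).1 h
  exact (hinj.bijective_of_nat_card_le hcard.le).surjective (MonoidHom.id G)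

/-- An injective homomorphism `f : G →* H` into a finite group has a right inverse as soon as
`|Hom(H,G)| = |Hom(H,H)|`, since postcomposition with `f` is then a bijection. -/
theorem MonoidHom.exists_comp_eq_id_of_injective {G H : Type*} [Group G] [Group H]
    [Finite H] (f : G →* H) (hf : Function.Injective f)
    (hcard : Nat.card (H →* G) = Nat.card (H →* H)) :
    ∃ g : H →* G, f.comp g = MonoidHom.id H := by
  have : Finite (H →* H) := DFunLike.finite _
  have hinj : Function.Injective fun g : H →* G => f.comp g :=
    fun _ _ h => (MonoidHom.cancel_left hf).1 h
  exact (hinj.bijective_of_nat_card_le hcard.ge).surjective (MonoidHom.id H)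

/-- For finite groups `G₁` and `G₂` the following are equivalent:
(i) `G₁ ≅ G₂`; (ii) there is a surjective homomorphism `G₁ →* G₂` and
`|Hom(G₁,G₁)| = |Hom(G₂,G₁)|`; (iii) there is an injective homomorphism `G₁ →* G₂` and
`|Hom(G₂,G₁)| = |Hom(G₂,G₂)|`. -/
theorem finite_group_iso_iff_epi_or_mono_and_count (G₁ G₂ : Type*) [Group G₁] [Group G₂]
    [Finite G₁] [Finite G₂] :
    List.TFAE
      [Nonempty (G₁ ≃* G₂),
       (∃ f : G₁ →* G₂, Function.Surjective f) ∧
         Nat.card (G₁ →* G₁) = Nat.card (G₂ →* G₁),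
       (∃ f : G₁ →* G₂, Function.Injective f) ∧
         Nat.card (G₂ →* G₁) = Nat.card (G₂ →* G₂)] := by
  tfae_have 1 → 2 := by
    rintro ⟨e⟩
    exact ⟨⟨e, e.surjective⟩, Nat.card_congr e.monoidHomCongrLeftEquiv⟩
  tfae_have 1 → 3 := by
    rintro ⟨e⟩
    exact ⟨⟨e, e.injective⟩, Nat.card_congr e.monoidHomCongrRightEquiv⟩
  tfae_have 2 → 1 := by
    rintro ⟨⟨f, hf⟩, hcard⟩
    obtain ⟨g, hg⟩ := f.exists_comp_eq_id_of_surjective hf hcard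
    have hinj : Function.Injective f :=
      Function.LeftInverse.injective (g := g) (DFunLike.congr_fun hg)
    exact ⟨MulEquiv.ofBijective f ⟨hinj, hf⟩⟩
  tfae_have 3 → 1 := by
    rintro ⟨⟨f, hf⟩, hcard⟩
    obtain ⟨g, hg⟩ := f.exists_comp_eq_id_of_injective hf hcard
    have hsurj : Function.Surjective f :=
      Function.RightInverse.surjective (g := g) (DFunLike.congr_fun hg)
    exact ⟨MulEquiv.ofBijective f ⟨hf, hsurj⟩⟩
  tfae_finish
end

section
/- Let G₁ and G₂ be finite groups, and assume that G₁ is simple. If |Hom(Gᵢ,G₁)| = |Hom(Gᵢ,G₂)| holds for i = 1, 2, then G₁ ≅ G₂. -/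
/-- If `G₁` and `G₂` are finite groups, `G₁` is simple, and
`|Hom(Gᵢ,G₁)| = |Hom(Gᵢ,G₂)|` for `i = 1, 2`, then `G₁ ≅ G₂`. -/
theorem simple_group_determined_by_homCount (G₁ G₂ : Type*) [Group G₁] [Group G₂]
    [Finite G₁] [Finite G₂] [IsSimpleGroup G₁]
    (h1 : Nat.card (G₁ →* G₁) = Nat.card (G₁ →* G₂))
    (h2 : Nat.card (G₂ →* G₁) = Nat.card (G₂ →* G₂)) :
    Nonempty (G₁ ≃* G₂) := by
  have : Finite (G₁ →* G₁) := DFunLike.finite _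
  have : Finite (G₁ →* G₂) := DFunLike.finite _
  have : Finite (G₂ →* G₁) := DFunLike.finite _
  have : Finite (G₂ →* G₂) := DFunLike.finite _
  have id_ne_one : MonoidHom.id G₁ ≠ 1 := by
    obtain ⟨g, hg⟩ := exists_ne (1 : G₁)
    exact fun h => hg (DFunLike.congr_fun h g)
  have : Nontrivial (G₁ →* G₁) := ⟨⟨_, _, id_ne_one⟩⟩
  have : Nontrivial (G₁ →* G₂) :=
    Finite.one_lt_card_iff_nontrivial.mp (h1 ▸ Finite.one_lt_card)
  obtain ⟨i, hi⟩ := exists_ne (1 : G₁ →* G₂)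
  -- A nontrivial homomorphism out of a simple group is injective.
  have i_injective : Function.Injective i := by
    rw [← MonoidHom.ker_eq_bot_iff]
    refine i.normal_ker.eq_bot_or_eq_top.resolve_right fun h => hi ?_
    exact MonoidHom.ker_eq_top_iff.mp h
  -- Composition with `i` is injective, hence bijective, so the identity of `G₂` factors through `i`.
  have comp_injective : Function.Injective fun f : G₂ →* G₁ => i.comp f :=
    fun _ _ h => (MonoidHom.cancel_left i_injective).mp h
  obtain ⟨f, hf⟩ :=
    ((Nat.bijective_iff_injective_and_card _).mpr ⟨comp_injective, h2⟩).surjective (MonoidHom.id G₂)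
  exact ⟨MulEquiv.ofBijective i ⟨i_injective, fun y => ⟨f y, DFunLike.congr_fun hf y⟩⟩⟩
end

section
/- Let G₁ and G₂ be finite groups. Assume G₂ is abelian and its exponent is square-free. If |Hom(G₁,Gᵢ)| = |Hom(G₂,Gᵢ)| holds for i = 1, 2, then G₁ ≅ G₂. -/
section SquarefreeExponent

open Finset

/-- A finite abelian group of square-free exponent is a product of cyclic groups of prime order. -/
theorem AddCommGroup.exists_addEquiv_pi_zmod_prime (G : Type*) [AddCommGroup G] [Finite G]
    (h : Squarefree (AddMonoid.exponent G)) :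
    ∃ (ι : Type) (_ : Fintype ι) (p : ι → ℕ),
      (∀ i, (p i).Prime) ∧ Nonempty (G ≃+ ∀ i, ZMod (p i)) := by
  classical
  obtain ⟨ι, _, p, hp, e, ⟨f⟩⟩ := AddCommGroup.equiv_directSum_zmod_of_finite G
  replace f := f.trans (DirectSum.addEquivProd fun i ↦ ZMod (p i ^ e i))
  have he (i : ι) : e i ≤ 1 := by
    have hdvd : p i ^ e i ∣ AddMonoid.exponent G := by
      rw [AddMonoid.exponent_eq_of_addEquiv f, AddMonoid.exponent_pi,
        ← ZMod.exponent (p i ^ e i)]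
      exact dvd_lcm (mem_univ i)
    by_contra! h2
    exact (hp i).not_isUnit (h _ ((sq (p i) ▸ pow_dvd_pow (p i) h2).trans hdvd))
  let r : (∀ i, ZMod (p i ^ e i)) →+ ∀ i : {i // e i ≠ 0}, ZMod (p i ^ e i) :=
    { toFun x i := x i
      map_zero' := rfl
      map_add' _ _ := rfl }
  have hr : Function.Bijective r := by
    constructor
    · intro x y hxy
      ext i
      by_cases hi : e i = 0
      · have : Subsingleton (ZMod (p i ^ e i)) := ZMod.subsingleton_iff.2 (by rw [hi, pow_zero])
        exact Subsingleton.elim _ _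
      · exact congrFun hxy ⟨i, hi⟩
    · intro y
      refine ⟨fun i ↦ if hi : e i ≠ 0 then y ⟨i, hi⟩ else 0, ?_⟩
      ext i
      simp [r, i.2]
  refine ⟨{i // e i ≠ 0}, inferInstance, fun i ↦ p i, fun i ↦ hp i,
    ⟨(f.trans (AddEquiv.ofBijective r hr)).trans (AddEquiv.piCongrRight fun i ↦
      (ZMod.ringEquivCongr ?_).toAddEquiv)⟩⟩
  rw [le_antisymm (he i) (Nat.one_le_iff_ne_zero.2 i.2), pow_one]

theorem ZMod.natCard_addMonoidHom {p q : ℕ} (hp : p.Prime) (hq : q.Prime) :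
    Nat.card (ZMod q →+ ZMod p) = if q = p then p else 1 := by
  split_ifs with h
  · subst h
    have e : (ZMod q →+ ZMod q) ≃ ZMod q :=
      (AddMonoidHom.toZModLinearMapEquiv q).toEquiv.trans
        (LinearMap.ringLmapEquivSelf (ZMod q) (ZMod q) (ZMod q)).toEquiv
    rw [Nat.card_congr e, Nat.card_zmod]
  · have : Subsingleton (ZMod q →+ ZMod p) := by
      refine subsingleton_of_forall_eq 0 fun f ↦ AddMonoidHom.ext fun x ↦ ?_
      have hqx : q • f x = 0 := by rw [← map_nsmul]; simp
      have hpx : p • f x = 0 := by simp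
      have := Nat.dvd_gcd (addOrderOf_dvd_of_nsmul_eq_zero hqx)
        (addOrderOf_dvd_of_nsmul_eq_zero hpx)
      rw [(Nat.coprime_primes hq hp).2 h] at this
      simpa using this
    exact Nat.card_unique

theorem natCard_addMonoidHom_pi_zmod {ι κ : Type*} [Fintype ι] [Fintype κ] {q : ι → ℕ}
    {p : κ → ℕ} (hq : ∀ i, (q i).Prime) (hp : ∀ j, (p j).Prime) :
    Nat.card ((∀ i, ZMod (q i)) →+ ∀ j, ZMod (p j)) = ∏ j, p j ^ #{i | q i = p j} := by
  classical
  have e₁ : ((∀ i, ZMod (q i)) →+ ∀ j, ZMod (p j)) ≃ ∀ j, (∀ i, ZMod (q i)) →+ ZMod (p j) :=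
    { toFun f j := (Pi.evalAddMonoidHom _ j).comp f
      invFun f := AddMonoidHom.pi f
      left_inv _ := rfl
      right_inv _ := rfl }
  have e₂ (j : κ) : ((∀ i, ZMod (q i)) →+ ZMod (p j)) ≃ ∀ i, ZMod (q i) →+ ZMod (p j) :=
    ((addMonoidHomLequivInt ℤ).toEquiv.trans
      (LinearMap.lsum ℤ (fun i ↦ ZMod (q i)) ℤ).symm.toEquiv).trans
      (Equiv.piCongrRight fun _ ↦ (addMonoidHomLequivInt ℤ).symm.toEquiv)
  rw [Nat.card_congr e₁, Nat.card_pi]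
  refine prod_congr rfl fun j _ ↦ ?_
  rw [Nat.card_congr (e₂ j), Nat.card_pi]
  simp_rw [ZMod.natCard_addMonoidHom (hp j) (hq _)]
  rw [prod_ite]
  simp

theorem nonempty_addEquiv_pi_zmod {ι κ : Type*} {q : ι → ℕ} {p : κ → ℕ}
    (e : ι ≃ κ) (h : ∀ i, p (e i) = q i) :
    Nonempty ((∀ i, ZMod (q i)) ≃+ ∀ j, ZMod (p j)) :=
  ⟨(AddEquiv.piCongrRight fun i ↦ (ZMod.ringEquivCongr (h i).symm).toAddEquiv).trans
    (RingEquiv.piCongrLeft (fun j ↦ ZMod (p j)) e).toAddEquiv⟩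

theorem Nat.factorization_prod_pow_prime {κ : Type*} [Fintype κ] {p : κ → ℕ}
    (hp : ∀ j, (p j).Prime) (a : ℕ → ℕ) (r : ℕ) :
    (∏ j, p j ^ a (p j)).factorization r = #{j | p j = r} * a r := by
  rw [Nat.factorization_prod fun j _ ↦ pow_ne_zero _ (hp j).ne_zero]
  simp only [Finsupp.finsetSum_apply, (hp _).factorization_pow, Finsupp.single_apply]
  rw [← sum_filter, sum_congr rfl (g := fun _ ↦ a r)]
  · simp
  · intro j hj
    rw [(mem_filter.1 hj).2]

/-- Among the finite abelian groups whose exponent divides that of `B`, the group `B` of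
square-free exponent is determined by the number of homomorphisms to `B`. -/
theorem AddCommGroup.nonempty_addEquiv_of_natCard_hom_eq {A B : Type*} [AddCommGroup A]
    [AddCommGroup B] [Finite A] [Finite B] (hB : Squarefree (AddMonoid.exponent B))
    (hAB : AddMonoid.exponent A ∣ AddMonoid.exponent B)
    (h : Nat.card (A →+ B) = Nat.card (B →+ B)) : Nonempty (A ≃+ B) := by
  classical
  obtain ⟨ι, _, q, hq, ⟨f⟩⟩ := exists_addEquiv_pi_zmod_prime A (hB.squarefree_of_dvd hAB)
  obtain ⟨κ, _, p, hp, ⟨g⟩⟩ := exists_addEquiv_pi_zmod_prime B hB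
  rw [Nat.card_congr (f.addMonoidHomCongrLeftEquiv.trans g.addMonoidHomCongrRightEquiv),
    Nat.card_congr (g.addMonoidHomCongrLeftEquiv.trans g.addMonoidHomCongrRightEquiv),
    natCard_addMonoidHom_pi_zmod hq hp, natCard_addMonoidHom_pi_zmod hp hp] at h
  have hcard (r : ℕ) : #{i | q i = r} = #{j | p j = r} := by
    have hr := congrArg (fun n ↦ n.factorization r) h
    simp only [Nat.factorization_prod_pow_prime hp (fun r ↦ #{i | q i = r}),
      Nat.factorization_prod_pow_prime hp (fun r ↦ #{j | p j = r})] at hr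
    rcases Nat.eq_zero_or_pos #{j | p j = r} with h0 | h0
    · rw [h0, card_eq_zero, filter_eq_empty_iff]
      rintro i - rfl
      have hdvd : q i ∣ univ.lcm p := by
        rw [AddMonoid.exponent_eq_of_addEquiv f, AddMonoid.exponent_eq_of_addEquiv g,
          AddMonoid.exponent_pi, AddMonoid.exponent_pi] at hAB
        simp only [ZMod.exponent] at hAB
        exact (dvd_lcm (mem_univ i)).trans hAB
      obtain ⟨j, -, hj⟩ := (hq i).prime.exists_mem_finset_dvd
        (hdvd.trans (Finset.lcm_dvd fun j hj ↦ dvd_prod_of_mem p hj))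
      exact filter_eq_empty_iff.1 (card_eq_zero.1 h0) (mem_univ j)
        ((Nat.prime_dvd_prime_iff_eq (hq i) (hp j)).1 hj).symm
    · exact Nat.eq_of_mul_eq_mul_left h0 hr
  have e (r : ℕ) : {i // q i = r} ≃ {j // p j = r} := Fintype.equivOfCardEq <| by
    simpa [Fintype.card_subtype] using hcard r
  obtain ⟨k⟩ := nonempty_addEquiv_pi_zmod (Equiv.ofFiberEquiv e) (Equiv.ofFiberEquiv_map e)
  exact ⟨(f.trans k).trans g.symm⟩

theorem CommGroup.nonempty_mulEquiv_of_natCard_hom_eq {A B : Type*} [CommGroup A]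
    [CommGroup B] [Finite A] [Finite B] (hB : Squarefree (Monoid.exponent B))
    (hAB : Monoid.exponent A ∣ Monoid.exponent B)
    (h : Nat.card (A →* B) = Nat.card (B →* B)) : Nonempty (A ≃* B) := by
  obtain ⟨f⟩ := AddCommGroup.nonempty_addEquiv_of_natCard_hom_eq (A := Additive A)
    (B := Additive B) (by simpa using hB) (by simpa using hAB)
    (by rwa [← Nat.card_congr MonoidHom.toAdditive, ← Nat.card_congr MonoidHom.toAdditive])
  exact ⟨MulEquiv.toAdditive.symm f⟩

/-- A finite group with as many homomorphisms to the abelian group `B` of square-free exponent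
as `B` itself admits a surjection onto `B`. -/
theorem exists_surjective_of_natCard_hom_eq {G B : Type*} [Group G] [CommGroup B] [Finite G]
    [Finite B] (hB : Squarefree (Monoid.exponent B))
    (h : Nat.card (G →* B) = Nat.card (B →* B)) :
    ∃ f : G →* B, Function.Surjective f := by
  set P := (powMonoidHom (α := Abelianization G) (Monoid.exponent B)).range with hP
  have hker (f : Abelianization G →* B) : P ≤ f.ker := by
    rintro _ ⟨x, rfl⟩
    simp [MonoidHom.mem_ker, Monoid.pow_exponent_eq_one]
  have hexp : Monoid.exponent (Abelianization G ⧸ P) ∣ Monoid.exponent B := by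
    refine Monoid.exponent_dvd_of_forall_pow_eq_one fun x ↦ ?_
    induction x using QuotientGroup.induction_on with
    | H x => exact (QuotientGroup.eq_one_iff _).2 ⟨x, rfl⟩
  let e : (G →* B) ≃ (Abelianization G ⧸ P →* B) := Abelianization.lift.trans
    { toFun f := QuotientGroup.lift P f (hker f)
      invFun f := f.comp (QuotientGroup.mk' P)
      left_inv _ := MonoidHom.ext fun _ ↦ rfl
      right_inv _ := QuotientGroup.monoidHom_ext P (MonoidHom.ext fun _ ↦ rfl) }
  rw [Nat.card_congr e] at h
  obtain ⟨k⟩ := CommGroup.nonempty_mulEquiv_of_natCard_hom_eq hB hexp h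
  exact ⟨(k.toMonoidHom.comp (QuotientGroup.mk' P)).comp Abelianization.of,
    (k.surjective.comp (QuotientGroup.mk'_surjective P)).comp QuotientGroup.mk_surjective⟩

/-- A surjection `G →* H` is injective as soon as `G` and `H` have equally many homomorphisms
to the finite group `G`. -/
theorem MonoidHom.injective_of_surjective_of_natCard_hom_eq {G H : Type*} [Group G] [Group H]
    [Finite G] {f : G →* H} (hf : Function.Surjective f)
    (h : Nat.card (G →* G) = Nat.card (H →* G)) : Function.Injective f := by
  have : Finite (G →* G) := Finite.of_injective _ DFunLike.coe_injective
  have hinj : Function.Injective fun g : H →* G ↦ g.comp f := fun _ _ hg ↦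
    (MonoidHom.cancel_right hf).1 hg
  obtain ⟨g, hg⟩ := ((Nat.bijective_iff_injective_and_card _).2 ⟨hinj, h.symm⟩).2 (MonoidHom.id G)
  exact Function.LeftInverse.injective (g := g) (DFunLike.congr_fun hg)

end SquarefreeExponent


/-- If `G₁` and `G₂` are finite groups, `G₂` is abelian with square-free
exponent, and `|Hom(G₁,Gᵢ)| = |Hom(G₂,Gᵢ)|` for `i = 1, 2`, then `G₁ ≅ G₂`. -/
theorem squarefree_exponent_abelian_determined_by_homCount (G₁ G₂ : Type*) [Group G₁]
    [CommGroup G₂] [Finite G₁] [Finite G₂] (hsf : Squarefree (Monoid.exponent G₂))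
    (h1 : Nat.card (G₁ →* G₁) = Nat.card (G₂ →* G₁))
    (h2 : Nat.card (G₁ →* G₂) = Nat.card (G₂ →* G₂)) :
    Nonempty (G₁ ≃* G₂) := by
  obtain ⟨f, hf⟩ := exists_surjective_of_natCard_hom_eq hsf h2
  exact ⟨MulEquiv.ofBijective f ⟨f.injective_of_surjective_of_natCard_hom_eq hf h1, hf⟩⟩
end

section
/- Two finite simple graphs G and H are isomorphic if and only if, for every finite simple graph F, the number of graph homomorphisms from F to G equals the number of graph homomorphisms from F to H. -/
namespace SimpleGraph

variable {U V W : Type*}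

/-- Homomorphisms with a given kernel correspond to injective homomorphisms from the quotient. -/
noncomputable def homKerEquivInjectiveHomQuotient (F : SimpleGraph U) (G : SimpleGraph V)
    (s : Setoid U) (hs : ∀ ⦃u v⦄, F.Adj u v → ¬ s u v) :
    {f : F →g G // Setoid.ker f = s} ≃
      {f : F.map (Quotient.mk s) →g G // Function.Injective f} where
  toFun f :=
    ⟨⟨Quotient.lift f.1 fun u v h ↦ by
        have hker : Setoid.ker f.1 u v := f.2.symm ▸ h
        exact hker, by
        intro a b hab
        obtain ⟨-, u, v, huv, rfl, rfl⟩ := (map_adj' _ _ _ _).1 hab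
        exact f.1.map_adj huv⟩, by
      rintro ⟨u⟩ ⟨v⟩ huv
      have hker : Setoid.ker f.1 u v := huv
      exact Quotient.sound (f.2 ▸ hker)⟩
  invFun f :=
    ⟨⟨fun u ↦ f.1 (Quotient.mk s u), fun {u v} huv ↦ f.1.map_adj <|
        map_adj_apply' huv fun h ↦ hs huv (Quotient.exact h)⟩, by
      ext u v
      exact ⟨fun h ↦ Quotient.exact (f.2 h), fun h ↦ congrArg f.1 (Quotient.sound h)⟩⟩
  left_inv f := by
    ext u
    rfl
  right_inv f := by
    ext ⟨u⟩
    rfl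

/-- Homomorphism counts split according to kernels. -/
theorem natCard_hom_eq_sum_ker [Finite U] [Fintype (Setoid U)] [Finite V]
    (F : SimpleGraph U) (G : SimpleGraph V) :
    Nat.card (F →g G) = ∑ s : Setoid U, Nat.card {f : F →g G // Setoid.ker f = s} := by
  rw [← Nat.card_sigma]
  exact Nat.card_congr (Equiv.sigmaFiberEquiv fun f : F →g G ↦ Setoid.ker f).symm

theorem natCard_injective_hom_eq_natCard_ker_bot (F : SimpleGraph U) (G : SimpleGraph V) :
    Nat.card {f : F →g G // Function.Injective f} =
      Nat.card {f : F →g G // Setoid.ker f = ⊥} :=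
  Nat.card_congr <| Equiv.subtypeEquivRight fun f ↦ Setoid.injective_iff_ker_bot f

theorem natCard_ker_eq_zero {F : SimpleGraph U} {G : SimpleGraph V} {s : Setoid U} {u v : U}
    (huv : F.Adj u v) (hs : s u v) : Nat.card {f : F →g G // Setoid.ker f = s} = 0 := by
  have : IsEmpty {f : F →g G // Setoid.ker f = s} :=
    ⟨fun ⟨f, hf⟩ ↦ (f.map_adj huv).ne (by subst hf; exact hs)⟩
  exact Nat.card_of_isEmpty

/-- Graphs with equal homomorphism counts have equal counts of injective homomorphisms. -/
theorem natCard_injective_hom_eq_of_natCard_hom_eq [Finite V] [Finite W]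
    {G : SimpleGraph V} {H : SimpleGraph W}
    (h : ∀ (U : Type) [Fintype U] (F : SimpleGraph U),
      Nat.card (F →g G) = Nat.card (F →g H))
    (U : Type) [Finite U] (F : SimpleGraph U) :
    Nat.card {f : F →g G // Function.Injective f} =
      Nat.card {f : F →g H // Function.Injective f} := by
  classical
  induction hn : Nat.card U using Nat.strong_induction_on generalizing U with
  | _ n ih =>
    have := Fintype.ofFinite U
    have : Finite (Setoid U) :=
      .of_injective (fun s : Setoid U ↦ s.r) fun _ _ hr ↦
        Setoid.ext fun a b ↦ iff_of_eq (congrFun₂ hr a b)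
    have := Fintype.ofFinite (Setoid U)
    have hker : ∀ s ∈ Finset.univ.erase (⊥ : Setoid U),
        Nat.card {f : F →g G // Setoid.ker f = s} =
          Nat.card {f : F →g H // Setoid.ker f = s} := by
      intro s hs
      by_cases hadj : ∀ ⦃u v⦄, F.Adj u v → ¬ s u v
      · rw [Nat.card_congr (homKerEquivInjectiveHomQuotient F G s hadj),
          Nat.card_congr (homKerEquivInjectiveHomQuotient F H s hadj)]
        refine ih _ ?_ _ _ rfl
        rw [← hn]
        refine (Nat.card_le_card_of_surjective _ (Quotient.mk_surjective (s := s))).lt_of_ne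
          fun hcard ↦ Finset.ne_of_mem_erase hs ?_
        have hinj := (Quotient.mk_surjective (s := s)).bijective_of_nat_card_le hcard.ge |>.1
        rw [← Setoid.ker_mk_eq s]
        exact (Setoid.injective_iff_ker_bot _).1 hinj
      · push Not at hadj
        obtain ⟨u, v, huv, hsuv⟩ := hadj
        rw [natCard_ker_eq_zero huv hsuv, natCard_ker_eq_zero huv hsuv]
    rw [natCard_injective_hom_eq_natCard_ker_bot, natCard_injective_hom_eq_natCard_ker_bot]
    have hsum := h U F
    rw [natCard_hom_eq_sum_ker, natCard_hom_eq_sum_ker,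
      ← Finset.add_sum_erase _ _ (Finset.mem_univ (⊥ : Setoid U)),
      ← Finset.add_sum_erase _ _ (Finset.mem_univ (⊥ : Setoid U)),
      Finset.sum_congr rfl hker] at hsum
    exact Nat.add_right_cancel hsum

/-- Finite graphs which map injectively into each other are isomorphic. -/
theorem nonempty_iso_of_injective_hom [Finite V] [Finite W] {G : SimpleGraph V}
    {H : SimpleGraph W} (f : G →g H) (g : H →g G) (hf : Function.Injective f)
    (hg : Function.Injective g) : Nonempty (G ≃g H) := by
  have hbij : Function.Bijective f :=
    hf.bijective_of_nat_card_le (Nat.card_le_card_of_injective g hg)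
  have hedge : Function.Surjective f.mapEdgeSet :=
    ((Hom.mapEdgeSet.injective f hf).bijective_of_nat_card_le
      (Nat.card_le_card_of_injective _ (Hom.mapEdgeSet.injective g hg))).2
  refine ⟨⟨Equiv.ofBijective f hbij, fun {u v} ↦ ⟨fun huv ↦ ?_, fun huv ↦ f.map_adj huv⟩⟩⟩
  obtain ⟨⟨e, he⟩, hfe⟩ := hedge ⟨s(f u, f v), huv⟩
  have heq : e = s(u, v) := Sym2.map.injective hf (congrArg Subtype.val hfe)
  rwa [heq] at he

/-- Isomorphic targets receive equally many homomorphisms. -/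
theorem Iso.natCard_hom_eq {G : SimpleGraph V} {H : SimpleGraph W} (e : G ≃g H)
    (F : SimpleGraph U) : Nat.card (F →g G) = Nat.card (F →g H) :=
  Nat.card_congr
    { toFun f := e.toHom.comp f
      invFun f := e.symm.toHom.comp f
      left_inv f := by ext; simp
      right_inv f := by ext; simp }

/-- Two finite graphs with equal homomorphism counts embed into each other as subgraphs. -/
theorem exists_injective_hom_of_natCard_hom_eq [Fintype V] [Finite W] {G : SimpleGraph V}
    {H : SimpleGraph W}
    (h : ∀ (U : Type) [Fintype U] (F : SimpleGraph U),
      Nat.card (F →g G) = Nat.card (F →g H)) :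
    ∃ f : G →g H, Function.Injective f := by
  let e := G.overFinIso rfl
  have hcard := natCard_injective_hom_eq_of_natCard_hom_eq h _ (G.overFin rfl)
  have : Nonempty {f : G.overFin rfl →g G // Function.Injective f} :=
    ⟨⟨e.symm.toHom, e.symm.injective⟩⟩
  have hpos := hcard ▸ Nat.card_pos (α := {f : G.overFin rfl →g G // Function.Injective f})
  obtain ⟨⟨f, hf⟩⟩ := (Nat.card_pos_iff.1 hpos).1
  exact ⟨f.comp e.toHom, hf.comp e.injective⟩

end SimpleGraph

/-- **Lovász.** Two finite simple graphs `G` and `H` are isomorphic iff for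
every finite simple graph `F` the number of graph homomorphisms `F → G` equals the number of
graph homomorphisms `F → H`. -/
theorem graph_iso_iff_homCount_eq {V W : Type*} [Fintype V] [Fintype W]
    (G : SimpleGraph V) (H : SimpleGraph W) :
    Nonempty (G ≃g H) ↔
      ∀ (U : Type) [Fintype U] (F : SimpleGraph U),
        Nat.card (F →g G) = Nat.card (F →g H) := by
  refine ⟨fun ⟨e⟩ U _ F ↦ e.natCard_hom_eq F, fun h ↦ ?_⟩
  obtain ⟨f, hf⟩ := SimpleGraph.exists_injective_hom_of_natCard_hom_eq h
  obtain ⟨g, hg⟩ :=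
    SimpleGraph.exists_injective_hom_of_natCard_hom_eq fun U _ F ↦ (h U F).symm
  exact SimpleGraph.nonempty_iso_of_injective_hom f g hf hg
end
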